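/- arXiv:1810.07763 — 3 statements merged into one kernel-verified Lean document; each statement's English description precedes it below -/
import Mathlib

section
/- Let 𝔞 be a finite-dimensional real Lie algebra with a nondegenerate invariant symmetric bilinear form K (so K([x,y],z) + K(y,[x,z]) = 0 for all x,y,z) and a direct sum decomposition 𝔞 = 𝔞₀ ⊕ 𝔞₁ satisfying [𝔞₀,𝔞₀] ⊆ 𝔞₀, [𝔞₀,𝔞₁] ⊆ 𝔞₁, [𝔞₁,𝔞₁] ⊆ 𝔞₀ and K(𝔞₀,𝔞₁) = 0. Then for all u, v ∈ 𝔞₁ the endomorphism x ↦ [u,[v,x]] of 𝔞 maps 𝔞₁ into 𝔞₁, and the trace of its restriction to 𝔞₁ equals (1/2)·κ(u,v), where κ is the Killing form of 𝔞. -/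
open LinearMap in
/-- Endomorphisms that are adjoint to each other with respect to a nondegenerate bilinear form have
the same trace. -/
theorem LinearMap.BilinForm.trace_eq_of_isAdjointPair {𝕜 V : Type*} [Field 𝕜] [AddCommGroup V]
    [Module 𝕜 V] [FiniteDimensional 𝕜 V] (B : LinearMap.BilinForm 𝕜 V)
    (hB : ∀ x, (∀ y, B x y = 0) → x = 0) {f g : V →ₗ[𝕜] V}
    (hfg : ∀ x y, B (f x) y = B x (g y)) :
    LinearMap.trace 𝕜 V f = LinearMap.trace 𝕜 V g := by
  have hinj : Function.Injective B :=
    (injective_iff_map_eq_zero B).2 fun x hx ↦ hB x fun y ↦ by simp [hx]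
  let e : V ≃ₗ[𝕜] Module.Dual 𝕜 V :=
    LinearEquiv.ofInjectiveOfFinrankEq B hinj Subspace.dual_finrank_eq.symm
  have hconj : e.conj f = Module.Dual.transpose g := by
    ext φ y
    obtain ⟨x, rfl⟩ := e.surjective φ
    rw [LinearEquiv.conj_apply_apply, e.symm_apply_apply]
    exact hfg x y
  rw [← trace_transpose' g, ← hconj, trace_conj' f e]

/-- For a finite-dimensional real Lie algebra `𝔞` with a nondegenerate
invariant symmetric bilinear form `K` and a decomposition `𝔞 = 𝔞₀ ⊕ 𝔞₁` with
`[𝔞₀,𝔞₀] ⊆ 𝔞₀`, `[𝔞₀,𝔞₁] ⊆ 𝔞₁`, `[𝔞₁,𝔞₁] ⊆ 𝔞₀`, `K(𝔞₀,𝔞₁) = 0`, for `u, v ∈ 𝔞₁`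
the endomorphism `x ↦ ⁅u,⁅v,x⁆⁆` maps `𝔞₁` into `𝔞₁` and the trace of its
restriction to `𝔞₁` equals `(1/2) κ(u,v)` where `κ` is the Killing form. -/
theorem stmt_0 {𝔞 : Type*} [LieRing 𝔞] [LieAlgebra ℝ 𝔞] [FiniteDimensional ℝ 𝔞]
    (K : LinearMap.BilinForm ℝ 𝔞)
    (hKsymm : ∀ x y, K x y = K y x)
    (hKnd : ∀ x, (∀ y, K x y = 0) → x = 0)
    (hKinv : ∀ x y z : 𝔞, K ⁅x, y⁆ z + K y ⁅x, z⁆ = 0)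
    (a0 a1 : Submodule ℝ 𝔞)
    (hcompl : IsCompl a0 a1)
    (h00 : ∀ x ∈ a0, ∀ y ∈ a0, ⁅x, y⁆ ∈ a0)
    (h01 : ∀ x ∈ a0, ∀ y ∈ a1, ⁅x, y⁆ ∈ a1)
    (h11 : ∀ x ∈ a1, ∀ y ∈ a1, ⁅x, y⁆ ∈ a0)
    (horth : ∀ x ∈ a0, ∀ y ∈ a1, K x y = 0)
    (u v : 𝔞) (hu : u ∈ a1) (hv : v ∈ a1) :
    ∃ h : ∀ x ∈ a1, ⁅u, ⁅v, x⁆⁆ ∈ a1,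
      LinearMap.trace ℝ a1
          (((LieAlgebra.ad ℝ 𝔞 u) ∘ₗ (LieAlgebra.ad ℝ 𝔞 v)).restrict h)
        = (1 / 2) * killingForm ℝ 𝔞 u v := by
  have h10 : ∀ x ∈ a1, ∀ y ∈ a0, ⁅x, y⁆ ∈ a1 := fun x hx y hy ↦ by
    rw [← lie_skew]
    exact a1.neg_mem (h01 y hy x hx)
  refine ⟨fun x hx ↦ h10 u hu _ (h11 v hv x hx), ?_⟩
  set A := LieAlgebra.ad ℝ 𝔞 u with hA
  set B := LieAlgebra.ad ℝ 𝔞 v with hB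
  let Q := a0.projection a1 hcompl
  let P := a1.projection a0 hcompl.symm
  have hQ0 : ∀ x ∈ a0, Q x = x := fun x hx ↦ Submodule.projection_apply_of_mem_left hcompl hx
  have hQ1 : ∀ x ∈ a1, Q x = 0 := fun x hx ↦ Submodule.projection_apply_of_mem_right hcompl hx
  have hP1 : ∀ x ∈ a1, P x = x := fun x hx ↦ Submodule.projection_apply_of_mem_left hcompl.symm hx
  have hP0 : ∀ x ∈ a0, P x = 0 := fun x hx ↦ Submodule.projection_apply_of_mem_right hcompl.symm hx
  have hdecomp : ∀ x : 𝔞, ∃ y ∈ a0, ∃ z ∈ a1, y + z = x := fun x ↦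
    Submodule.mem_sup.1 (hcompl.sup_eq_top ▸ Submodule.mem_top)
  have hPQ : P + Q = 1 := Submodule.projection_add_projection_eq_id hcompl.symm
  have hPA : P * A = A * Q := by
    ext x
    obtain ⟨y, hy, z, hz, rfl⟩ := hdecomp x
    simp [hA, hQ0 y hy, hQ1 z hz, hP1 _ (h10 u hu y hy), hP0 _ (h11 u hu z hz)]
  have hKQ : ∀ x y, K (Q x) y = K x (Q y) := fun x y ↦ by
    obtain ⟨x₀, hx₀, x₁, hx₁, rfl⟩ := hdecomp x
    obtain ⟨y₀, hy₀, y₁, hy₁, rfl⟩ := hdecomp y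
    simp [hQ0 x₀ hx₀, hQ1 x₁ hx₁, hQ0 y₀ hy₀, hQ1 y₁ hy₁, horth x₀ hx₀ y₁ hy₁, hKsymm x₁ y₀,
      horth y₀ hy₀ x₁ hx₁]
  have hKad : ∀ w x y : 𝔞, K ⁅w, x⁆ y = -K x ⁅w, y⁆ := fun w x y ↦
    eq_neg_of_add_eq_zero_left (hKinv w x y)
  have hrestrict : LinearMap.trace ℝ a1 ((A ∘ₗ B).restrict
      fun x hx ↦ h10 u hu _ (h11 v hv x hx)) = LinearMap.trace ℝ 𝔞 (P * (A * B)) := by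
    have hmem : ∀ x, (P * (A * B)) x ∈ a1 := fun x ↦ Submodule.projection_apply_mem hcompl.symm _
    rw [← LinearMap.trace_restrict_eq_of_forall_mem a1 _ hmem]
    congr 1
    ext x
    exact (hP1 _ (h10 u hu _ (h11 v hv x x.2))).symm
  have hadj : LinearMap.trace ℝ 𝔞 (Q * (B * A)) = LinearMap.trace ℝ 𝔞 ((A * B) * Q) :=
    K.trace_eq_of_isAdjointPair hKnd fun x y ↦ by simp [hA, hB, hKQ, hKad]
  have hcycle : LinearMap.trace ℝ 𝔞 (P * (A * B)) = LinearMap.trace ℝ 𝔞 (Q * (A * B)) := by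
    rw [← mul_assoc, hPA, mul_assoc, LinearMap.trace_mul_comm, mul_assoc, hadj,
      LinearMap.trace_mul_comm]
  have hsum : LinearMap.trace ℝ 𝔞 (P * (A * B)) + LinearMap.trace ℝ 𝔞 (Q * (A * B)) =
      killingForm ℝ 𝔞 u v := by
    rw [← map_add, ← add_mul, hPQ, one_mul]
    rfl
  rw [hrestrict]
  linarith
end

section
/- Let 𝔤 be a quadratic Lie algebra, i.e. a finite-dimensional real Lie algebra with a nondegenerate symmetric bilinear form ⟨·,·⟩ satisfying ⟨[x,y],z⟩ + ⟨y,[x,z]⟩ = 0, and let V₊ ⊆ 𝔤 be a generalized pseudometric with V₋ = V₊^⊥ and projections P₊, P₋. For e ∈ 𝔤 define GRic_{V₊,e}(a₊,b₋) := ⟨e, P₊[b₋,a₊]⟩ − Tr_{V₊}(x ↦ P₊[P₋[x,b₋], a₊]) and GRic_{V₋,e}(b₋,a₊) := ⟨e, P₋[a₊,b₋]⟩ − Tr_{V₋}(y ↦ P₋[P₊[y,a₊], b₋]). Then for all a₊ ∈ V₊, b₋ ∈ V₋ and e ∈ 𝔤: GRic_{V₋,e}(b₋,a₊) = GRic_{V₊,e}(a₊,b₋)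 + ⟨[e,a₊], b₋⟩. In particular, for e = 0, Tr_{V₊}(x ↦ P₊[P₋[x,b₋], a₊]) = Tr_{V₋}(y ↦ P₋[P₊[y,a₊], b₋]). -/
section GRic

variable {𝔤 : Type*} [LieRing 𝔤] [LieAlgebra ℝ 𝔤] [FiniteDimensional ℝ 𝔤]

/-- `GRic_{V₊,e}(a₊,b₋) = ⟨e, P₊[b₋,a₊]⟩ − Tr_{V₊}(x ↦ P₊[P₋[x,b₋],a₊])`, where
`P₊` is the projection onto `V₊` (along `V₋ = V₊^⊥`) and `P₋ = id − P₊`.  Note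
that `x ↦ P₊[P₋[x,b],a] = P₊ ∘ ad a ∘ (id − P₊) ∘ ad b` since the two signs from
`[y,z] = −[z,y]` cancel. -/
noncomputable def gricP (Bf : LinearMap.BilinForm ℝ 𝔤) (Vp : Submodule ℝ 𝔤)
    (Pp : 𝔤 →ₗ[ℝ] 𝔤) (hPp : ∀ x, Pp x ∈ Vp) (e a b : 𝔤) : ℝ :=
  Bf e (Pp ⁅b, a⁆) -
    LinearMap.trace ℝ Vp
      ((Pp ∘ₗ LieAlgebra.ad ℝ 𝔤 a ∘ₗ (LinearMap.id - Pp) ∘ₗ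
          LieAlgebra.ad ℝ 𝔤 b).restrict (fun x _ => hPp _))

/-- `GRic_{V₋,e}(b₋,a₊) = ⟨e, P₋[a₊,b₋]⟩ − Tr_{V₋}(y ↦ P₋[P₊[y,a₊],b₋])`, with
`V₋ = V₊^⊥` and `P₋ = id − P₊` (mapping into `V₋`). -/
noncomputable def gricM (Bf : LinearMap.BilinForm ℝ 𝔤) (Vp : Submodule ℝ 𝔤)
    (Pp : 𝔤 →ₗ[ℝ] 𝔤)
    (hPm : ∀ x, x - Pp x ∈ LinearMap.BilinForm.orthogonal Bf Vp)
    (e a b : 𝔤) : ℝ :=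
  Bf e (⁅a, b⁆ - Pp ⁅a, b⁆) -
    LinearMap.trace ℝ (LinearMap.BilinForm.orthogonal Bf Vp)
      (((LinearMap.id - Pp) ∘ₗ LieAlgebra.ad ℝ 𝔤 b ∘ₗ Pp ∘ₗ
          LieAlgebra.ad ℝ 𝔤 a).restrict (fun y _ => hPm _))

end GRic

/-- for a quadratic Lie algebra `𝔤` with generalized pseudometric
`V₊` (with `V₋ = V₊^⊥`, projections `P₊`, `P₋ = id − P₊`), for all `a₊ ∈ V₊`,
`b₋ ∈ V₋` and `e ∈ 𝔤`:
`GRic_{V₋,e}(b₋,a₊) = GRic_{V₊,e}(a₊,b₋) + ⟨[e,a₊],b₋⟩`; in particular (`e = 0`)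
the two trace terms agree. -/
theorem stmt_4 {𝔤 : Type*} [LieRing 𝔤] [LieAlgebra ℝ 𝔤] [FiniteDimensional ℝ 𝔤]
    (Bf : LinearMap.BilinForm ℝ 𝔤)
    (hsymm : ∀ x y, Bf x y = Bf y x)
    (hnd : ∀ x, (∀ y, Bf x y = 0) → x = 0)
    (hinv : ∀ x y z : 𝔤, Bf ⁅x, y⁆ z + Bf y ⁅x, z⁆ = 0)
    (Vp : Submodule ℝ 𝔤)
    (hVpnd : ∀ x ∈ Vp, (∀ y ∈ Vp, Bf x y = 0) → x = 0)
    (Pp : 𝔤 →ₗ[ℝ] 𝔤)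
    (hPp : ∀ x, Pp x ∈ Vp)
    (hPm : ∀ x, x - Pp x ∈ LinearMap.BilinForm.orthogonal Bf Vp)
    (e a b : 𝔤) (ha : a ∈ Vp) (hb : b ∈ LinearMap.BilinForm.orthogonal Bf Vp) :
    gricM Bf Vp Pp hPm e a b = gricP Bf Vp Pp hPp e a b + Bf ⁅e, a⁆ b ∧
    LinearMap.trace ℝ Vp
        ((Pp ∘ₗ LieAlgebra.ad ℝ 𝔤 a ∘ₗ (LinearMap.id - Pp) ∘ₗ
            LieAlgebra.ad ℝ 𝔤 b).restrict (fun x _ => hPp _))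
      = LinearMap.trace ℝ (LinearMap.BilinForm.orthogonal Bf Vp)
          (((LinearMap.id - Pp) ∘ₗ LieAlgebra.ad ℝ 𝔤 b ∘ₗ Pp ∘ₗ
              LieAlgebra.ad ℝ 𝔤 a).restrict (fun y _ => hPm _)) := by
  have htrace : LinearMap.trace ℝ Vp
        ((Pp ∘ₗ LieAlgebra.ad ℝ 𝔤 a ∘ₗ (LinearMap.id - Pp) ∘ₗ
            LieAlgebra.ad ℝ 𝔤 b).restrict (fun x _ => hPp _))
      = LinearMap.trace ℝ (LinearMap.BilinForm.orthogonal Bf Vp)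
          (((LinearMap.id - Pp) ∘ₗ LieAlgebra.ad ℝ 𝔤 b ∘ₗ Pp ∘ₗ
              LieAlgebra.ad ℝ 𝔤 a).restrict (fun y _ => hPm _)) := by
    refine (LinearMap.trace_restrict_eq_of_forall_mem Vp
      (Pp ∘ₗ LieAlgebra.ad ℝ 𝔤 a ∘ₗ (LinearMap.id - Pp) ∘ₗ LieAlgebra.ad ℝ 𝔤 b)
      fun _ => hPp _).trans (Eq.trans ?_
      (LinearMap.trace_restrict_eq_of_forall_mem (LinearMap.BilinForm.orthogonal Bf Vp)
        ((LinearMap.id - Pp) ∘ₗ LieAlgebra.ad ℝ 𝔤 b ∘ₗ Pp ∘ₗ LieAlgebra.ad ℝ 𝔤 a)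
        fun _ => hPm _).symm)
    exact LinearMap.trace_comp_comm' ((LinearMap.id - Pp) ∘ₗ LieAlgebra.ad ℝ 𝔤 b)
      (Pp ∘ₗ LieAlgebra.ad ℝ 𝔤 a)
  refine ⟨?_, htrace⟩
  have hae := hinv a e b
  rw [← lie_skew a e, ← lie_skew a b] at hae
  rw [gricM, gricP, ← htrace, ← lie_skew a b]
  simp only [map_neg, map_sub, LinearMap.neg_apply] at hae ⊢
  linarith
end

section
/- Let 𝔤 be a quadratic Lie algebra with invariant pairing ⟨·,·⟩, V₊ ⊆ 𝔤 a generalized pseudometric with V₋ = V₊^⊥ and projections P₊, P₋. Let 𝔰 ⊆ 𝔤 be an isotropic Lie subalgebra (⟨𝔰,𝔰⟩ = 0) such that ⟨𝔰, V₊⟩ = 0 and [s, V₊] ⊆ V₊ for all s ∈ 𝔰 (so 𝔰 ⊆ V₋), and let e ∈ 𝔤 satisfy ⟨e, [s,x]⟩ = 0 for all s ∈ 𝔰 and x ∈ 𝔤. Then GRic_{V₊,e}(a₊, s) = 0 for all a₊ ∈ V₊ and s ∈ 𝔰, where GRic_{V₊,e}(a₊,b₋) := ⟨e, P₊[b₋,a₊]⟩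 − Tr_{V₊}(x ↦ P₊[P₋[x,b₋], a₊]). -/
/-- let `𝔤` be a quadratic Lie algebra, `V₊` a generalized
pseudometric (with `V₋ = V₊^⊥` and projections `P₊`, `P₋ = id − P₊`), `𝔰 ⊆ 𝔤` an
isotropic Lie subalgebra with `⟨𝔰,V₊⟩ = 0` and `[𝔰,V₊] ⊆ V₊`, and `e ∈ 𝔤` with
`⟨e,[s,x]⟩ = 0` for all `s ∈ 𝔰`, `x ∈ 𝔤`.  Then `GRic_{V₊,e}(a₊, s) = 0` for all
`a₊ ∈ V₊` and `s ∈ 𝔰`. -/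
theorem stmt_6 {𝔤 : Type*} [LieRing 𝔤] [LieAlgebra ℝ 𝔤] [FiniteDimensional ℝ 𝔤]
    (Bf : LinearMap.BilinForm ℝ 𝔤)
    (hsymm : ∀ x y, Bf x y = Bf y x)
    (hnd : ∀ x, (∀ y, Bf x y = 0) → x = 0)
    (hinv : ∀ x y z : 𝔤, Bf ⁅x, y⁆ z + Bf y ⁅x, z⁆ = 0)
    (Vp : Submodule ℝ 𝔤)
    (hVpnd : ∀ x ∈ Vp, (∀ y ∈ Vp, Bf x y = 0) → x = 0)
    (Pp : 𝔤 →ₗ[ℝ] 𝔤)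
    (hPp : ∀ x, Pp x ∈ Vp)
    (hPm : ∀ x, x - Pp x ∈ LinearMap.BilinForm.orthogonal Bf Vp)
    (𝔰 : LieSubalgebra ℝ 𝔤)
    (hiso : ∀ s ∈ 𝔰, ∀ s' ∈ 𝔰, Bf s s' = 0)
    (hsV : ∀ s ∈ 𝔰, ∀ x ∈ Vp, Bf s x = 0)
    (hsbr : ∀ s ∈ 𝔰, ∀ x ∈ Vp, ⁅s, x⁆ ∈ Vp)
    (e : 𝔤) (he : ∀ s ∈ 𝔰, ∀ x : 𝔤, Bf e ⁅s, x⁆ = 0) :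
    ∀ a ∈ Vp, ∀ s ∈ 𝔰, gricP Bf Vp Pp hPp e a s = 0 := by
  have hP : ∀ y ∈ Vp, Pp y = y := fun y hy =>
    (sub_eq_zero.mp (hVpnd _ (Vp.sub_mem hy (hPp y)) fun z hz =>
      (hsymm _ _).trans (hPm y z hz))).symm
  intro a ha s hs
  have htr : (Pp ∘ₗ LieAlgebra.ad ℝ 𝔤 a ∘ₗ (LinearMap.id - Pp) ∘ₗ
      LieAlgebra.ad ℝ 𝔤 s).restrict (fun x (_ : x ∈ Vp) => hPp _) = 0 := by
    ext x
    simp [LinearMap.restrict_apply, hP _ (hsbr s hs x x.2)]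
  rw [gricP, htr, hP _ (hsbr s hs a ha), he s hs a, map_zero, sub_zero]
end
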